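/- Let n > 2 and g ∈ ℕ. The ℂ-linear map Φ from the dual space of Σ̄_{n,g} to S_{n,g} defined by Φ(ψ) := Σ ψ(ē₂^{k₂}⋯ēₙ^{kₙ})·U_{k₂,…,kₙ} (sum over all (k₂,…,kₙ) ∈ ℕ^{n−1} with 2k₂+⋯+nkₙ = g) is a linear isomorphism, and Φ maps the annihilator of O_{n,g} := Σ̄_{n,g} ∩ qₙ·Aₙ onto the space Dec_{n,g} of decomposable U-invariants. -/

import Mathlib

open MvPolynomial TensorProduct

noncomputable section

/-- The potenziante `π_{n,g} = ∑_{r₁+⋯+rₙ=g} λ₁^{r₁}⋯λₙ^{rₙ} ⊗ a_{r₁}⋯a_{rₙ}`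
as an element of `ℂ[λ₁,…,λₙ] ⊗_ℂ R`, where `R = ℂ[a₀,a₁,…] = MvPolynomial ℕ ℂ`. -/
def pot (n g : ℕ) : MvPolynomial (Fin n) ℂ ⊗[ℂ] MvPolynomial ℕ ℂ :=
  ∑ r ∈ Finset.Nat.antidiagonalTuple n g,
    (∏ i : Fin n, X i ^ r i) ⊗ₜ[ℂ] (∏ i : Fin n, X (r i))

/-- The tuples `(k₁,…,kₙ) ∈ ℕⁿ` with `k₁ + 2k₂ + ⋯ + nkₙ = g`. -/
def wtT (n g : ℕ) : Finset (Fin n → ℕ) :=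
  (Fintype.piFinset fun _ : Fin n => Finset.range (g + 1)).filter
    (fun k => ∑ i : Fin n, ((i : ℕ) + 1) * k i = g)

/-- The tuples `(k₂,…,kₙ) ∈ ℕ^{n-1}` with `2k₂ + 3k₃ + ⋯ + nkₙ = g`. -/
def wtT' (n g : ℕ) : Finset (Fin (n - 1) → ℕ) :=
  (Fintype.piFinset fun _ : Fin (n - 1) => Finset.range (g + 1)).filter
    (fun k => ∑ i : Fin (n - 1), ((i : ℕ) + 2) * k i = g)

/-- `(k₂,…,kₙ) ↦ (0,k₂,…,kₙ)`. -/
def extend0 {n : ℕ} (k : Fin (n - 1) → ℕ) : Fin n → ℕ :=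
  fun i => if h : 0 < (i : ℕ) then k ⟨(i : ℕ) - 1, by have := i.isLt; omega⟩ else 0

/-- `R_{n,g}`: the ℂ-span of the monomials of degree `n` and weight `g` in
`R = ℂ[a₀,a₁,…] = MvPolynomial ℕ ℂ` (with `aᵢ = X i`). -/
def Rng (n g : ℕ) : Submodule ℂ (MvPolynomial ℕ ℂ) :=
  Submodule.span ℂ {p : MvPolynomial ℕ ℂ | ∃ m : ℕ →₀ ℕ,
    (m.sum fun _ e => e) = n ∧ (m.sum fun i e => i * e) = g ∧ p = monomial m 1}

/-- `S_{n,g} = (ker D) ∩ R_{n,g}`: the `U`-invariants of degree `n` and weight `g`. -/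
def Sng (D : Derivation ℂ (MvPolynomial ℕ ℂ) (MvPolynomial ℕ ℂ)) (n g : ℕ) :
    Submodule ℂ (MvPolynomial ℕ ℂ) :=
  LinearMap.ker (D : MvPolynomial ℕ ℂ →ₗ[ℂ] MvPolynomial ℕ ℂ) ⊓ Rng n g

/-- `Dec_{n,g} = ∑_{h=1}^{n-1} ∑_{j=0}^{g} S_{h,j}·S_{n-h,g-j}`: the decomposable
`U`-invariants of degree `n` and weight `g`. -/
def Dec (D : Derivation ℂ (MvPolynomial ℕ ℂ) (MvPolynomial ℕ ℂ)) (n g : ℕ) :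
    Submodule ℂ (MvPolynomial ℕ ℂ) :=
  ⨆ h ∈ Finset.Icc 1 (n - 1), ⨆ j ∈ Finset.range (g + 1),
    Sng D h j * Sng D (n - h) (g - j)

/-- `λ̄ᵢ` (`i = 1,…,n`) in `Aₙ = ℂ[λ₁,…,λₙ]/(λ₁+⋯+λₙ)`, identified with the polynomial
ring `ℂ[λ̄₁,…,λ̄_{n-1}]` via `λ̄ₙ = −(λ̄₁+⋯+λ̄_{n-1})`. -/
def lamb (n : ℕ) (i : Fin n) : MvPolynomial (Fin (n - 1)) ℂ :=
  if h : (i : ℕ) < n - 1 then X ⟨(i : ℕ), h⟩ else -(∑ j : Fin (n - 1), X j)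

/-- `λ̄_T := ∑_{i∈T} λ̄ᵢ` for a subset `T ⊆ {1,…,n}`. -/
def lamT (n : ℕ) (T : Finset (Fin n)) : MvPolynomial (Fin (n - 1)) ℂ :=
  ∑ i ∈ T, lamb n i

/-- `p_h`: for `2h < n` the product of the `λ̄_T` over all `T` with `|T| = h`; for
`n = 2h` the product over those `T` with `|T| = h` containing the first index. -/
def pP (n h : ℕ) : MvPolynomial (Fin (n - 1)) ℂ :=
  if 2 * h < n then ∏ T ∈ Finset.powersetCard h (Finset.univ : Finset (Fin n)), lamT n T
  else ∏ T ∈ (Finset.powersetCard h (Finset.univ : Finset (Fin n))).filter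
      (fun T => ∃ i : Fin n, i ∈ T ∧ (i : ℕ) = 0), lamT n T

/-- `qₙ := p₁ p₂ ⋯ p_m`, `m = ⌊n/2⌋`. -/
def qP (n : ℕ) : MvPolynomial (Fin (n - 1)) ℂ :=
  ∏ h ∈ Finset.Icc 1 (n / 2), pP n h

/-- The induced `Sₙ`-action on `Aₙ ≅ ℂ[λ̄₁,…,λ̄_{n-1}]`, permuting `λ̄₁,…,λ̄ₙ`. -/
def permAct (n : ℕ) (σ : Equiv.Perm (Fin n)) :
    MvPolynomial (Fin (n - 1)) ℂ →ₐ[ℂ] MvPolynomial (Fin (n - 1)) ℂ :=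
  aeval (fun j : Fin (n - 1) => lamb n (σ (Fin.castLE (Nat.sub_le n 1) j)))

/-- `Σ̄_{n,g}`: the `Sₙ`-invariant elements of `Aₙ ≅ ℂ[λ̄₁,…,λ̄_{n-1}]` homogeneous of
degree `g`. -/
def SigmaBar (n g : ℕ) : Submodule ℂ (MvPolynomial (Fin (n - 1)) ℂ) :=
  homogeneousSubmodule (Fin (n - 1)) ℂ g ⊓
    ⨅ σ : Equiv.Perm (Fin n),
      LinearMap.ker ((permAct n σ).toLinearMap - LinearMap.id)

/-- `ēⱼ`: the image in `ℂ[λ̄₁,…,λ̄_{n-1}]` of the `j`-th elementary symmetric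
polynomial `eⱼ(λ₁,…,λₙ)`. -/
def ebar (n j : ℕ) : MvPolynomial (Fin (n - 1)) ℂ :=
  ∑ T ∈ Finset.powersetCard j (Finset.univ : Finset (Fin n)), ∏ i ∈ T, lamb n i

/-- The linear combination `∑ c_r • a_{r₁}⋯a_{rₙ}` over the tuples `r` of sum `g`. -/
def tupleComb (n g : ℕ) (c : (Fin n → ℕ) → ℂ) : MvPolynomial ℕ ℂ :=
  ∑ r ∈ Finset.Nat.antidiagonalTuple n g, c r • ∏ i, X (r i)

theorem prod_X_eq_monomial {n : ℕ} (r : Fin n → ℕ) :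
    (∏ i, X (r i) : MvPolynomial ℕ ℂ) = monomial (∑ i, Finsupp.single (r i) 1) 1 := by
  rw [monomial_sum_one]
  rfl

theorem toMultiset_sum_single {n : ℕ} (t : Fin n → ℕ) :
    Finsupp.toMultiset (∑ i, Finsupp.single (t i) 1) = (List.ofFn t : Multiset ℕ) := by
  rw [map_sum, ← Fin.univ_val_map, ← Multiset.sum_map_singleton (Multiset.map t _),
    Multiset.map_map]
  simp only [Finsupp.toMultiset_single, one_smul]
  rfl

theorem sum_finset_sum_single {n : ℕ} (t : Fin n → ℕ) (f : ℕ → ℕ) :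
    ((∑ i, Finsupp.single (t i) 1 : ℕ →₀ ℕ).sum fun j e => f j * e) = ∑ i, f (t i) := by
  rw [← Finsupp.sum_finsetSum_index (by simp) (by simp [mul_add])]
  simp

theorem exists_perm_of_sum_single_eq {n : ℕ} {r s : Fin n → ℕ}
    (h : ∑ i, Finsupp.single (r i) 1 = ∑ i, Finsupp.single (s i) 1) :
    ∃ σ : Equiv.Perm (Fin n), r = s ∘ σ := by
  have hp : List.Perm (List.ofFn r) (List.ofFn s) := by
    rw [← Multiset.coe_eq_coe, ← toMultiset_sum_single, ← toMultiset_sum_single, h]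
  have he : r ∘ Tuple.sort r = s ∘ Tuple.sort s := by
    apply List.ofFn_injective
    refine List.Perm.eq_of_pairwise' (r := (· ≤ ·)) (Tuple.monotone_sort r).sortedLE_ofFn.pairwise
      (Tuple.monotone_sort s).sortedLE_ofFn.pairwise ?_
    exact ((Tuple.sort r).ofFn_comp_perm r).trans
      (hp.trans ((Tuple.sort s).ofFn_comp_perm s).symm)
  refine ⟨(Tuple.sort r)⁻¹.trans (Tuple.sort s), ?_⟩
  funext i
  have := congrFun he ((Tuple.sort r)⁻¹ i)
  simpa using this

theorem comp_perm_mem_antidiagonalTuple {n g : ℕ} {r : Fin n → ℕ} (σ : Equiv.Perm (Fin n))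
    (hr : r ∈ Finset.Nat.antidiagonalTuple n g) :
    r ∘ σ ∈ Finset.Nat.antidiagonalTuple n g := by
  rw [Finset.Nat.mem_antidiagonalTuple] at hr ⊢
  rw [← hr]
  exact Equiv.sum_comp σ r

theorem tupleComb_comp_perm {n g : ℕ} (c : (Fin n → ℕ) → ℂ) (σ : Equiv.Perm (Fin n)) :
    tupleComb n g (fun r => c (r ∘ σ)) = tupleComb n g c := by
  refine Finset.sum_nbij' (fun r => r ∘ σ) (fun r => r ∘ σ.symm)
    (fun r hr => comp_perm_mem_antidiagonalTuple σ hr)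
    (fun r hr => comp_perm_mem_antidiagonalTuple σ.symm hr) ?_ ?_ ?_
  · intro r _; funext i; simp
  · intro r _; funext i; simp
  · intro r _
    congr 1
    exact (Equiv.prod_comp σ (fun i => (X (r i) : MvPolynomial ℕ ℂ))).symm

theorem tupleComb_symmetrize {n g : ℕ} (c : (Fin n → ℕ) → ℂ) :
    tupleComb n g (fun r => ∑ σ : Equiv.Perm (Fin n), c (r ∘ σ))
      = (n.factorial : ℂ) • tupleComb n g c := by
  have : tupleComb n g (fun r => ∑ σ : Equiv.Perm (Fin n), c (r ∘ σ))
      = ∑ σ : Equiv.Perm (Fin n), tupleComb n g (fun r => c (r ∘ σ)) := by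
    simp only [tupleComb, Finset.sum_smul]
    rw [Finset.sum_comm]
  rw [this, Finset.sum_congr rfl (fun σ _ => tupleComb_comp_perm c σ)]
  simp [Fintype.card_perm, Nat.cast_smul_eq_nsmul]

theorem eq_zero_of_tupleComb_eq_zero {n g : ℕ} {c : (Fin n → ℕ) → ℂ}
    (hc : ∀ r (σ : Equiv.Perm (Fin n)), c (r ∘ σ) = c r) (h : tupleComb n g c = 0)
    {s : Fin n → ℕ} (hs : ∑ i, s i = g) : c s = 0 := by
  classical
  have h1 := congrArg (coeff (∑ i, Finsupp.single (s i) 1)) h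
  simp only [tupleComb, coeff_sum, coeff_smul, prod_X_eq_monomial, coeff_monomial, coeff_zero,
    smul_eq_mul, mul_ite, mul_one, mul_zero] at h1
  rw [← Finset.sum_filter, Finset.sum_congr rfl (g := fun _ => c s), Finset.sum_const,
    smul_eq_zero] at h1
  · refine h1.resolve_left (Finset.card_ne_zero_of_mem (a := s) ?_)
    simp [Finset.Nat.mem_antidiagonalTuple, hs]
  · intro r hr
    obtain ⟨σ, rfl⟩ := exists_perm_of_sum_single_eq (Finset.mem_filter.1 hr).2
    exact hc s σ

theorem derivation_prod {D : Derivation ℂ (MvPolynomial ℕ ℂ) (MvPolynomial ℕ ℂ)} {ι : Type*}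
    [DecidableEq ι] (s : Finset ι) (f : ι → MvPolynomial ℕ ℂ) :
    D (∏ i ∈ s, f i) = ∑ i ∈ s, (∏ j ∈ s.erase i, f j) * D (f i) := by
  induction s using Finset.induction_on with
  | empty => simp
  | insert a s ha ih =>
    rw [Finset.prod_insert ha, Derivation.leibniz, ih, Finset.sum_insert ha,
      Finset.erase_insert ha, smul_eq_mul, smul_eq_mul, add_comm, Finset.mul_sum]
    congr 1
    refine Finset.sum_congr rfl fun i hi => ?_
    have : a ≠ i := fun h => ha (h ▸ hi)
    rw [Finset.erase_insert_of_ne this, Finset.prod_insert (by simp [ha]), mul_assoc]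

theorem derivation_tupleComb_zero {D : Derivation ℂ (MvPolynomial ℕ ℂ) (MvPolynomial ℕ ℂ)}
    (hD0 : D (X 0) = 0) (n : ℕ) (c : (Fin n → ℕ) → ℂ) : D (tupleComb n 0 c) = 0 := by
  simp [tupleComb, Finset.Nat.antidiagonalTuple_zero_right, hD0]

theorem derivation_tupleComb_succ {D : Derivation ℂ (MvPolynomial ℕ ℂ) (MvPolynomial ℕ ℂ)}
    (hD0 : D (X 0) = 0) (hD : ∀ i : ℕ, D (X (i + 1)) = X i) (n g : ℕ) (c : (Fin n → ℕ) → ℂ) :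
    D (tupleComb n (g + 1) c) = tupleComb n g (fun s => ∑ i, c (s + Pi.single i 1)) := by
  classical
  simp only [tupleComb, map_sum, Derivation.map_smul, derivation_prod, Finset.sum_smul,
    Finset.smul_sum]
  rw [Finset.sum_comm, Finset.sum_comm (s := Finset.Nat.antidiagonalTuple n g)]
  refine Finset.sum_congr rfl fun i _ => (Finset.sum_of_injOn (fun s => s + Pi.single i 1)
    (fun s _ t _ h => add_right_cancel h) ?_ ?_ ?_).symm
  · intro s hs
    simp only [Finset.mem_coe, Finset.Nat.mem_antidiagonalTuple] at hs ⊢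
    simp [Finset.sum_add_distrib, hs]
  · intro r hr hr'
    have : r i = 0 := by
      by_contra h0
      apply hr'
      refine ⟨r - Pi.single i 1, ?_, ?_⟩
      · have h1 : r = (r - Pi.single i 1) + Pi.single i 1 := by
          funext j
          rcases eq_or_ne j i with rfl | hj
          · simp; omega
          · simp [hj]
        rw [Finset.Nat.mem_antidiagonalTuple, h1] at hr
        simp only [Pi.add_apply, Finset.sum_add_distrib, Finset.sum_pi_single',
          Finset.mem_univ, if_true] at hr
        simpa [Finset.Nat.mem_antidiagonalTuple] using hr
      · funext j
        rcases eq_or_ne j i with rfl | hj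
        · simp; omega
        · simp [hj]
    simp [this, hD0]
  · intro s _
    congr 1
    rw [← Finset.prod_erase_mul _ _ (Finset.mem_univ i)]
    simp only [Pi.add_apply, Pi.single_eq_same, hD]
    congr 1
    refine Finset.prod_congr rfl fun j hj => ?_
    simp [(Finset.mem_erase.1 hj).1]

theorem tupleComb_mem_Rng (n g : ℕ) (c : (Fin n → ℕ) → ℂ) : tupleComb n g c ∈ Rng n g := by
  refine Submodule.sum_mem _ fun r hr => Submodule.smul_mem _ _ (Submodule.subset_span ?_)
  refine ⟨∑ i, Finsupp.single (r i) 1, ?_, ?_, prod_X_eq_monomial r⟩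
  · simpa using sum_finset_sum_single r 1
  · exact (sum_finset_sum_single r id).trans (Finset.Nat.mem_antidiagonalTuple.1 hr)

theorem tupleComb_add (n g : ℕ) (c d : (Fin n → ℕ) → ℂ) :
    tupleComb n g (c + d) = tupleComb n g c + tupleComb n g d := by
  simp [tupleComb, add_smul, Finset.sum_add_distrib]

theorem tupleComb_smul (n g : ℕ) (a : ℂ) (c : (Fin n → ℕ) → ℂ) :
    tupleComb n g (a • c) = a • tupleComb n g c := by
  simp [tupleComb, Finset.smul_sum, smul_smul]

theorem exists_tupleComb_eq {n g : ℕ} {p : MvPolynomial ℕ ℂ} (hp : p ∈ Rng n g) :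
    ∃ c : (Fin n → ℕ) → ℂ, tupleComb n g c = p := by
  classical
  induction hp using Submodule.span_induction with
  | mem p h =>
    obtain ⟨m, hn, hg, rfl⟩ := h
    have hcard : (Finsupp.toMultiset m).toList.length = n := by
      rw [Multiset.length_toList, Finsupp.card_toMultiset]
      exact hn
    obtain ⟨s, hs⟩ : ∃ s : Fin n → ℕ, (List.ofFn s : Multiset ℕ) = Finsupp.toMultiset m := by
      subst hcard
      exact ⟨(Finsupp.toMultiset m).toList.get, by rw [List.ofFn_get, Multiset.coe_toList]⟩
    have hsm : ∑ i, Finsupp.single (s i) 1 = m := by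
      apply Multiset.toFinsupp.symm.injective
      exact (toMultiset_sum_single s).trans hs
    refine ⟨Pi.single s 1, ?_⟩
    rw [tupleComb, Finset.sum_eq_single s]
    · simp [prod_X_eq_monomial, hsm]
    · intro r _ hr
      simp [Pi.single_eq_of_ne hr]
    · intro hs'
      refine absurd ?_ hs'
      rw [Finset.Nat.mem_antidiagonalTuple, ← hg, ← hsm]
      exact (sum_finset_sum_single s id).symm
  | zero => exact ⟨0, by simp [tupleComb]⟩
  | add p q _ _ hp hq =>
    obtain ⟨c, rfl⟩ := hp
    obtain ⟨d, rfl⟩ := hq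
    exact ⟨c + d, tupleComb_add ..⟩
  | smul a p _ hp =>
    obtain ⟨c, rfl⟩ := hp
    exact ⟨a • c, tupleComb_smul ..⟩

theorem exists_symmetric_tupleComb_eq {n g : ℕ} {p : MvPolynomial ℕ ℂ} (hp : p ∈ Rng n g) :
    ∃ c : (Fin n → ℕ) → ℂ, (∀ r (σ : Equiv.Perm (Fin n)), c (r ∘ σ) = c r) ∧
      tupleComb n g c = p := by
  obtain ⟨c, rfl⟩ := exists_tupleComb_eq hp
  refine ⟨(n.factorial : ℂ)⁻¹ • fun r => ∑ σ : Equiv.Perm (Fin n), c (r ∘ σ), ?_, ?_⟩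
  · intro r σ
    simp only [Pi.smul_apply]
    congr 1
    exact Equiv.sum_comp (Equiv.mulLeft σ) (fun τ : Equiv.Perm (Fin n) => c (r ∘ τ))
  · rw [tupleComb_smul, tupleComb_symmetrize, smul_smul, inv_mul_cancel₀, one_smul]
    exact_mod_cast n.factorial_ne_zero

theorem sum_lamb (n : ℕ) : ∑ i, lamb n i = 0 := by
  cases n with
  | zero => simp
  | succ m => simp [Fin.sum_univ_castSucc, lamb]

/-- The algebra morphism `Aₙ → B` with `λ̄ᵢ ↦ bᵢ`, for a family `b` of sum zero. -/
def liftA {B : Type*} [CommRing B] [Algebra ℂ B] {n : ℕ} (b : Fin n → B) :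
    MvPolynomial (Fin (n - 1)) ℂ →ₐ[ℂ] B :=
  aeval fun j => b (Fin.castLE (Nat.sub_le n 1) j)

theorem liftA_lamb {B : Type*} [CommRing B] [Algebra ℂ B] {n : ℕ} {b : Fin n → B}
    (hb : ∑ i, b i = 0) (i : Fin n) : liftA b (lamb n i) = b i := by
  cases n with
  | zero => exact i.elim0
  | succ m =>
    induction i using Fin.lastCases with
    | last =>
      rw [Fin.sum_univ_castSucc, add_comm] at hb
      have h : lamb (m + 1) (Fin.last m) = -∑ j : Fin m, X j := by simp [lamb]
      rw [h, map_neg, map_sum, eq_neg_of_add_eq_zero_left hb]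
      congr 1
      exact Finset.sum_congr rfl fun j _ => aeval_X _ j
    | cast j =>
      have h : lamb (m + 1) j.castSucc = X j := by simp [lamb]
      rw [h]
      exact aeval_X _ j

theorem algHom_ext_lamb {B : Type*} [CommRing B] [Algebra ℂ B] {n : ℕ}
    {f f' : MvPolynomial (Fin (n - 1)) ℂ →ₐ[ℂ] B} (h : ∀ i, f (lamb n i) = f' (lamb n i)) :
    f = f' := by
  refine MvPolynomial.algHom_ext fun j => ?_
  have := h (Fin.castLE (Nat.sub_le n 1) j)
  simpa [lamb] using this

theorem permAct_lamb {n : ℕ} (σ : Equiv.Perm (Fin n)) (i : Fin n) :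
    permAct n σ (lamb n i) = lamb n (σ i) :=
  liftA_lamb (b := fun i => lamb n (σ i)) ((Equiv.sum_comp σ _).trans (sum_lamb n)) i

theorem monomial_eq_prod_X_pow {n : ℕ} (m : Fin n →₀ ℕ) :
    (monomial m 1 : MvPolynomial (Fin n) ℂ) = ∏ i, X i ^ m i := by
  rw [monomial_eq, C_1, one_mul, Finsupp.prod_fintype _ _ (by simp)]

/-- `∑ φ(λ̄₁^{r₁}⋯λ̄ₙ^{rₙ}) • a_{r₁}⋯a_{rₙ}`: the evaluation of `φ` on the left factor of the
image of the potenziante in `Aₙ ⊗ R`. -/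
def theta (n g : ℕ) (φ : Module.Dual ℂ (MvPolynomial (Fin (n - 1)) ℂ)) : MvPolynomial ℕ ℂ :=
  tupleComb n g fun r => φ (∏ i, lamb n i ^ r i)

section Invariants

variable {D : Derivation ℂ (MvPolynomial ℕ ℂ) (MvPolynomial ℕ ℂ)}

theorem theta_mem_Sng (hD0 : D (X 0) = 0) (hD : ∀ i : ℕ, D (X (i + 1)) = X i) (n g : ℕ)
    (φ : Module.Dual ℂ (MvPolynomial (Fin (n - 1)) ℂ)) : theta n g φ ∈ Sng D n g := by
  refine ⟨?_, tupleComb_mem_Rng n g _⟩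
  change D (theta n g φ) = 0
  cases g with
  | zero => exact derivation_tupleComb_zero hD0 n _
  | succ g =>
    have : (fun s : Fin n → ℕ => ∑ i, φ (∏ j, lamb n j ^ (s + Pi.single i 1 : Fin n → ℕ) j))
        = 0 := by
      funext s
      have h : ∀ i, ∏ j, lamb n j ^ (s + Pi.single i 1 : Fin n → ℕ) j
          = (∏ j, lamb n j ^ s j) * lamb n i := fun i => by
        simp only [Pi.add_apply, pow_add, Finset.prod_mul_distrib]
        congr 1
        rw [Finset.prod_eq_single i (by intro j _ hj; simp [hj]) (by simp)]
        simp
      simp only [h, ← map_sum, ← Finset.mul_sum, sum_lamb, mul_zero, map_zero, Pi.zero_apply]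
    rw [theta, derivation_tupleComb_succ hD0 hD, this]
    simp [tupleComb]

theorem apply_rename_eq {n : ℕ} {ψ : Module.Dual ℂ (MvPolynomial (Fin n) ℂ)}
    (hψ : ∀ f, ψ ((∑ i, X i) * f) = 0) (f : MvPolynomial (Fin n) ℂ) :
    ψ (rename (Fin.castLE (Nat.sub_le n 1)) (aeval (lamb n) f)) = ψ f := by
  set I : Ideal (MvPolynomial (Fin n) ℂ) := Ideal.span {∑ i, X i} with hI
  have h0 : ∑ i, Ideal.Quotient.mkₐ ℂ I (X i) = 0 := by
    rw [← map_sum]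
    exact Ideal.Quotient.eq_zero_iff_mem.2 (Ideal.subset_span rfl)
  have h1 : (Ideal.Quotient.mkₐ ℂ I).comp (rename (Fin.castLE (Nat.sub_le n 1)))
      = liftA fun i => Ideal.Quotient.mkₐ ℂ I (X i) :=
    MvPolynomial.algHom_ext fun j => by simp [liftA]
  have h2 : ((Ideal.Quotient.mkₐ ℂ I).comp (rename (Fin.castLE (Nat.sub_le n 1)))).comp
      (aeval (lamb n)) = Ideal.Quotient.mkₐ ℂ I := by
    refine MvPolynomial.algHom_ext fun i => ?_
    rw [AlgHom.comp_apply, aeval_X, h1, liftA_lamb h0]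
  have h3 := Ideal.Quotient.eq.1 (DFunLike.congr_fun h2 f)
  obtain ⟨q, hq⟩ := Ideal.mem_span_singleton'.1 h3
  rw [mul_comm] at hq
  rw [← sub_eq_zero, ← map_sub]
  exact (congrArg ψ hq).symm.trans (hψ q)

theorem exists_theta_eq (hD0 : D (X 0) = 0) (hD : ∀ i : ℕ, D (X (i + 1)) = X i) {n g : ℕ}
    {p : MvPolynomial ℕ ℂ} (hp : p ∈ Sng D n g) :
    ∃ φ : Module.Dual ℂ (MvPolynomial (Fin (n - 1)) ℂ),
      (∀ r : Fin n → ℕ, ∑ i, r i ≠ g → φ (∏ i, lamb n i ^ r i) = 0) ∧ theta n g φ = p := by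
  classical
  obtain ⟨hDp, hp⟩ := hp
  replace hDp : D p = 0 := hDp
  obtain ⟨c, hc, rfl⟩ := exists_symmetric_tupleComb_eq hp
  set ψ : Module.Dual ℂ (MvPolynomial (Fin n) ℂ) :=
    (basisMonomials (Fin n) ℂ).constr ℂ (fun m => if ∑ i, m i = g then c m else 0) with hψ
  have hψm : ∀ m : Fin n →₀ ℕ, ψ (monomial m 1) = if ∑ i, m i = g then c m else 0 := fun m => by
    have h : (monomial m 1 : MvPolynomial (Fin n) ℂ) = basisMonomials (Fin n) ℂ m := by
      rw [coe_basisMonomials]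
    rw [hψ, h, Module.Basis.constr_basis]
  have hψ0 : ∀ f, ψ ((∑ i, X i) * f) = 0 := by
    intro f
    induction f using MvPolynomial.induction_on' with
    | add f f' hf hf' => rw [mul_add, map_add, hf, hf', add_zero]
    | monomial m a =>
      have h : (∑ i, X i) * monomial m a
          = a • ∑ i, (monomial (m + Finsupp.single i 1) 1 : MvPolynomial (Fin n) ℂ) := by
        rw [Finset.sum_mul, Finset.smul_sum]
        refine Finset.sum_congr rfl fun i _ => ?_
        rw [X, monomial_mul, one_mul, add_comm, smul_monomial, smul_eq_mul, mul_one]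
      rw [h, map_smul, map_sum]
      simp only [hψm, Finsupp.add_apply, Finset.sum_add_distrib]
      by_cases hm : ∑ i, m i + 1 = g
      · subst hm
        rw [derivation_tupleComb_succ hD0 hD] at hDp
        have := eq_zero_of_tupleComb_eq_zero (c := fun s => ∑ i, c (s + Pi.single i 1))
          (fun r σ => ?_) hDp (s := m) rfl
        · rw [← smul_zero a, ← this]
          congr 1
          refine Finset.sum_congr rfl fun i _ => ?_
          rw [if_pos]
          · congr 1
            funext j
            simp [Finsupp.single_apply, Pi.single_apply, eq_comm]
          · simp [Finsupp.single_apply]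
        · refine Eq.trans ?_ (Equiv.sum_comp σ fun i => c (r + Pi.single i 1))
          refine Finset.sum_congr rfl fun i _ => ?_
          rw [← hc (r + Pi.single (σ i) 1) σ]
          congr 1
          funext j
          simp [Pi.single_apply]
      · rw [Finset.sum_eq_zero, smul_zero]
        intro i _
        rw [if_neg]
        simpa [Finsupp.single_apply] using hm
  have hφ : ∀ r : Fin n → ℕ, ψ (rename (Fin.castLE (Nat.sub_le n 1)) (∏ i, lamb n i ^ r i))
      = if ∑ i, r i = g then c r else 0 := by
    intro r
    have h1 : ∏ i, lamb n i ^ r i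
        = aeval (lamb n) (monomial (Finsupp.equivFunOnFinite.symm r) (1 : ℂ)) := by
      simp [monomial_eq_prod_X_pow]
    rw [h1, apply_rename_eq hψ0, hψm]
    simp
  refine ⟨ψ ∘ₗ (rename (Fin.castLE (Nat.sub_le n 1))).toLinearMap, ?_, ?_⟩
  · intro r hr
    exact (hφ r).trans (if_neg hr)
  · rw [theta, tupleComb]
    refine Finset.sum_congr rfl fun r hr => ?_
    congr 1
    exact (hφ r).trans (if_pos (Finset.Nat.mem_antidiagonalTuple.1 hr))

end Invariants

theorem permAct_eq_of_mem_SigmaBar {n g : ℕ} {f : MvPolynomial (Fin (n - 1)) ℂ}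
    (hf : f ∈ SigmaBar n g) (σ : Equiv.Perm (Fin n)) : permAct n σ f = f := by
  have := (Submodule.mem_iInf _).1 hf.2 σ
  simpa [sub_eq_zero] using this

theorem apply_eq_zero_of_theta_eq_zero {n g : ℕ}
    {φ : Module.Dual ℂ (MvPolynomial (Fin (n - 1)) ℂ)} (h : theta n g φ = 0)
    {f : MvPolynomial (Fin (n - 1)) ℂ} (hf : f ∈ SigmaBar n g) : φ f = 0 := by
  have hsum : ∀ r : Fin n → ℕ, ∑ i, r i = g →
      ∑ σ : Equiv.Perm (Fin n), φ (permAct n σ (∏ i, lamb n i ^ r i)) = 0 := by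
    intro r hr
    have h0 := tupleComb_symmetrize (n := n) (g := g) fun r => φ (∏ i, lamb n i ^ r i)
    rw [show tupleComb n g (fun r => φ (∏ i, lamb n i ^ r i)) = 0 from h, smul_zero] at h0
    rw [← eq_zero_of_tupleComb_eq_zero (fun r σ => ?_) h0 hr]
    · rw [← Equiv.sum_comp (Equiv.inv (Equiv.Perm (Fin n)))
        fun σ : Equiv.Perm (Fin n) => φ (∏ i, lamb n i ^ (r ∘ σ) i)]
      refine Finset.sum_congr rfl fun σ _ => ?_
      simp only [map_prod, map_pow, permAct_lamb]
      rw [← Equiv.prod_comp σ fun i => lamb n i ^ (r ∘ (Equiv.inv (Equiv.Perm (Fin n)) σ)) i]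
      simp
    · exact Equiv.sum_comp (Equiv.mulLeft σ)
        (fun τ : Equiv.Perm (Fin n) => φ (∏ i, lamb n i ^ (r ∘ τ) i))
  have hmon : ∀ m : Fin (n - 1) →₀ ℕ, m.degree = g →
      ∑ σ : Equiv.Perm (Fin n), φ (permAct n σ (monomial m 1)) = 0 := by
    intro m hm
    rw [Finsupp.degree_eq_sum] at hm
    have : ∃ r : Fin n → ℕ, ∑ i, r i = g ∧ (monomial m 1 : MvPolynomial (Fin (n - 1)) ℂ)
        = ∏ i, lamb n i ^ r i := by
      cases n with
      | zero => exact ⟨0, by simpa using hm, by rw [monomial_eq_prod_X_pow]; rfl⟩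
      | succ k =>
        refine ⟨Fin.snoc (α := fun _ => ℕ) m 0, ?_, ?_⟩
        · simpa [Fin.sum_univ_castSucc] using hm
        · simp [monomial_eq_prod_X_pow, Fin.prod_univ_castSucc, lamb]
    obtain ⟨r, hr, he⟩ := this
    rw [he, hsum r hr]
  have htot : ∑ σ : Equiv.Perm (Fin n), φ (permAct n σ f) = 0 := by
    rw [f.as_sum]
    simp only [map_sum]
    rw [Finset.sum_comm]
    refine Finset.sum_eq_zero fun m hm => ?_
    have hmg : m.degree = g := by
      by_contra hne
      exact (mem_support_iff.1 hm) (((mem_homogeneousSubmodule g f).1 hf.1).coeff_eq_zero hne)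
    have h1 : monomial m (coeff m f) = coeff m f • (monomial m 1 : MvPolynomial _ ℂ) := by
      rw [smul_monomial, smul_eq_mul, mul_one]
    simp only [h1, map_smul, ← Finset.smul_sum, hmon m hmg, smul_zero]
  simp only [permAct_eq_of_mem_SigmaBar hf, Finset.sum_const, Finset.card_univ,
    Fintype.card_perm, Fintype.card_fin,
    smul_eq_zero] at htot
  exact htot.resolve_left n.factorial_ne_zero

/-- The algebra morphism `A_{h+k} → A_h ⊗ A_k` with `λ̄ᵢ ↦ λ̄ᵢ ⊗ 1` for `i ≤ h` and
`λ̄_{h+j} ↦ 1 ⊗ λ̄ⱼ`. -/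
def splitA (h k : ℕ) : MvPolynomial (Fin (h + k - 1)) ℂ →ₐ[ℂ]
    MvPolynomial (Fin (h - 1)) ℂ ⊗[ℂ] MvPolynomial (Fin (k - 1)) ℂ :=
  liftA (Fin.append (fun i => lamb h i ⊗ₜ 1) (fun j => 1 ⊗ₜ lamb k j))

theorem splitA_lamb (h k : ℕ) (i : Fin (h + k)) : splitA h k (lamb (h + k) i)
    = Fin.append (fun i => lamb h i ⊗ₜ[ℂ] 1) (fun j => 1 ⊗ₜ lamb k j) i := by
  refine liftA_lamb ?_ i
  simp [Fin.sum_univ_add, ← TensorProduct.sum_tmul, ← TensorProduct.tmul_sum, sum_lamb]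

theorem splitA_prod_pow (h k : ℕ) (r : Fin (h + k) → ℕ) :
    splitA h k (∏ i, lamb (h + k) i ^ r i) = (∏ i, lamb h i ^ r (Fin.castAdd k i)) ⊗ₜ[ℂ]
      ∏ j, lamb k j ^ r (Fin.natAdd h j) := by
  have hl : ∀ x : MvPolynomial (Fin (h - 1)) ℂ,
      x ⊗ₜ[ℂ] (1 : MvPolynomial (Fin (k - 1)) ℂ) = Algebra.TensorProduct.includeLeft (S := ℂ) x :=
    fun _ => rfl
  have hr : ∀ y : MvPolynomial (Fin (k - 1)) ℂ,
      (1 : MvPolynomial (Fin (h - 1)) ℂ) ⊗ₜ[ℂ] y = Algebra.TensorProduct.includeRight y :=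
    fun _ => rfl
  rw [map_prod, Fin.prod_univ_add]
  simp only [map_pow, splitA_lamb, Fin.append_left, Fin.append_right]
  rw [← one_mul (∏ j, lamb k j ^ r (Fin.natAdd h j)), ← mul_one (∏ i, lamb h i ^ _),
    ← Algebra.TensorProduct.tmul_mul_tmul]
  simp only [hl, hr, map_pow, map_prod]

theorem theta_splitA (h k g : ℕ) (φ₁ : Module.Dual ℂ (MvPolynomial (Fin (h - 1)) ℂ))
    (φ₂ : Module.Dual ℂ (MvPolynomial (Fin (k - 1)) ℂ)) :
    theta (h + k) g (dualDistrib ℂ _ _ (φ₁ ⊗ₜ φ₂) ∘ₗ (splitA h k).toLinearMap)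
      = ∑ p ∈ Finset.HasAntidiagonal.antidiagonal g, theta h p.1 φ₁ * theta k p.2 φ₂ := by
  have key : ∀ p ∈ Finset.HasAntidiagonal.antidiagonal g, theta h p.1 φ₁ * theta k p.2 φ₂ =
      ∑ q ∈ Finset.Nat.antidiagonalTuple h p.1 ×ˢ Finset.Nat.antidiagonalTuple k p.2,
        (φ₁ (∏ i, lamb h i ^ q.1 i) * φ₂ (∏ i, lamb k i ^ q.2 i)) •
          ((∏ i, X (q.1 i)) * ∏ i, X (q.2 i) : MvPolynomial ℕ ℂ) := by
    intro p _
    rw [theta, theta, tupleComb, tupleComb, Finset.sum_mul_sum, Finset.sum_product]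
    simp only [smul_mul_smul_comm]
  rw [Finset.sum_congr rfl key, Finset.sum_sigma', theta, tupleComb]
  refine Finset.sum_nbij' (fun r => ⟨(∑ i : Fin h, r (Fin.castAdd k i),
      ∑ j : Fin k, r (Fin.natAdd h j)), (fun i => r (Fin.castAdd k i),
      fun j => r (Fin.natAdd h j))⟩) (fun x => Fin.append x.2.1 x.2.2) ?_ ?_ ?_ ?_ ?_
  · intro r hr
    simp only [Finset.Nat.mem_antidiagonalTuple, Fin.sum_univ_add] at hr
    simpa [Finset.Nat.mem_antidiagonalTuple] using hr
  · rintro ⟨⟨a, b⟩, r, s⟩ hx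
    simp only [Finset.mem_sigma, Finset.HasAntidiagonal.mem_antidiagonal, Finset.mem_product,
      Finset.Nat.mem_antidiagonalTuple] at hx
    simp [Finset.Nat.mem_antidiagonalTuple, Fin.sum_univ_add, hx]
  · intro r _
    exact Fin.append_castAdd_natAdd
  · rintro ⟨⟨a, b⟩, r, s⟩ hx
    simp only [Finset.mem_sigma, Finset.HasAntidiagonal.mem_antidiagonal, Finset.mem_product,
      Finset.Nat.mem_antidiagonalTuple] at hx
    obtain ⟨-, rfl, rfl⟩ := hx
    simp
  · intro r _
    congr 1
    · rw [LinearMap.comp_apply, AlgHom.toLinearMap_apply, splitA_prod_pow,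
        TensorProduct.dualDistrib_apply]
    · exact Fin.prod_univ_add _

theorem lamT_dvd_of_splitA_eq_zero {h k : ℕ} {f : MvPolynomial (Fin (h + k - 1)) ℂ}
    (hf : splitA h k f = 0) :
    lamT (h + k) (Finset.univ.map (Fin.castAddEmb k)) ∣ f := by
  set I := Ideal.span {lamT (h + k) (Finset.univ.map (Fin.castAddEmb k))} with hI
  set b : Fin (h + k) → MvPolynomial (Fin (h + k - 1)) ℂ ⧸ I :=
    fun i => Ideal.Quotient.mkₐ ℂ I (lamb (h + k) i) with hb
  have hl : ∑ i : Fin h, b (Fin.castAdd k i) = 0 := by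
    rw [hb, ← map_sum]
    refine Ideal.Quotient.eq_zero_iff_mem.2 (Ideal.subset_span ?_)
    simp [lamT]
  have hr : ∑ j : Fin k, b (Fin.natAdd h j) = 0 := by
    have h0 : ∑ i, b i = 0 := by rw [hb, ← map_sum, sum_lamb, map_zero]
    rwa [Fin.sum_univ_add, hl, zero_add] at h0
  have hc : (Algebra.TensorProduct.productMap (liftA fun i => b (Fin.castAdd k i))
      (liftA fun j => b (Fin.natAdd h j))).comp (splitA h k) = Ideal.Quotient.mkₐ ℂ I := by
    refine algHom_ext_lamb fun i => ?_
    rw [AlgHom.comp_apply, splitA_lamb]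
    induction i using Fin.addCases with
    | left i => simp [liftA_lamb hl]; rfl
    | right j => simp [liftA_lamb hr]; rfl
  have h1 := DFunLike.congr_fun hc f
  rw [AlgHom.comp_apply, hf, map_zero] at h1
  exact Ideal.mem_span_singleton.1 (Ideal.Quotient.eq_zero_iff_mem.1 h1.symm)

theorem splitA_lamT (h k : ℕ) :
    splitA h k (lamT (h + k) (Finset.univ.map (Fin.castAddEmb k))) = 0 := by
  simp [lamT, splitA_lamb, ← TensorProduct.sum_tmul, sum_lamb]

theorem lamT_compl (n : ℕ) (T : Finset (Fin n)) : lamT n Tᶜ = -lamT n T :=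
  eq_neg_of_add_eq_zero_left ((Finset.sum_compl_add_sum T _).trans (sum_lamb n))

theorem liftA_single_sub_single {n : ℕ} (i j : Fin n) (T : Finset (Fin n)) :
    liftA (Pi.single i 1 - Pi.single j 1 : Fin n → ℂ) (lamT n T)
      = (if i ∈ T then 1 else 0) - if j ∈ T then 1 else 0 := by
  rw [lamT, map_sum]
  simp only [liftA_lamb (b := (Pi.single i 1 - Pi.single j 1 : Fin n → ℂ)) (by simp)]
  simp

theorem isHomogeneous_lamT (n : ℕ) (T : Finset (Fin n)) : (lamT n T).IsHomogeneous 1 := by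
  refine IsHomogeneous.sum _ _ _ fun i _ => ?_
  unfold lamb
  split_ifs
  · exact isHomogeneous_X _ _
  · exact (IsHomogeneous.sum _ _ _ fun j _ => isHomogeneous_X _ _).neg

theorem irreducible_lamT {n : ℕ} {T : Finset (Fin n)} (hT : T.Nonempty) (hT' : T ≠ Finset.univ) :
    Irreducible (lamT n T) := by
  obtain ⟨i, hi⟩ := hT
  obtain ⟨j, hj⟩ : ∃ j, j ∉ T := by simpa [Finset.eq_univ_iff_forall] using hT'
  have h0 : lamT n T ≠ 0 := fun h => by
    have := liftA_single_sub_single i j T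
    simp [h, hi, hj] at this
  refine irreducible_of_totalDegree_eq_one ((isHomogeneous_lamT n T).totalDegree h0) fun x hx => ?_
  obtain ⟨m, hm⟩ := ne_zero_iff.1 h0
  refine isUnit_iff_ne_zero.2 fun hx0 => hm ?_
  simpa [hx0] using hx m

theorem isRelPrime_lamT {n : ℕ} {T T' : Finset (Fin n)} (hT : T.Nonempty) (hT' : T ≠ Finset.univ)
    (hS : T'.Nonempty) (hS' : T' ≠ Finset.univ) (hne : T' ≠ T) (hne' : T' ≠ Tᶜ) :
    IsRelPrime (lamT n T) (lamT n T') := by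
  rw [(irreducible_lamT hT hT').isRelPrime_iff_not_dvd]
  rintro ⟨q, hq⟩
  obtain ⟨i, j, hij, hi, hj⟩ : ∃ i j, (i ∈ T ↔ j ∈ T) ∧ i ∈ T' ∧ j ∉ T' := by
    by_contra! hcon
    obtain ⟨a, ha⟩ := hS
    obtain ⟨b, hb⟩ : ∃ j, j ∉ T' := by simpa [Finset.eq_univ_iff_forall] using hS'
    have hab : ¬(a ∈ T ↔ b ∈ T) := fun h => hb (hcon a b h ha)
    by_cases haT : a ∈ T
    · refine hne (Finset.ext fun x => ⟨fun hx => ?_, fun hx => hcon a x (by tauto) ha⟩)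
      by_contra hxT
      exact hb (hcon x b (by tauto) hx)
    · refine hne' (Finset.ext fun x => ?_)
      rw [Finset.mem_compl]
      refine ⟨fun hx hxT => hb (hcon x b (by tauto) hx), fun hx => hcon a x (by tauto) ha⟩
  have h1 := liftA_single_sub_single i j T'
  rw [hq, map_mul, liftA_single_sub_single] at h1
  simp [hij, hi, hj] at h1

/-- The index sets `T` of the factors `λ̄_T` of `qₙ`. -/
def IsFactor {n : ℕ} (T : Finset (Fin n)) : Prop :=
  2 * T.card < n ∨ 2 * T.card = n ∧ ∃ i ∈ T, (i : ℕ) = 0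

theorem pP_eq {n h : ℕ} (hh : h ∈ Finset.Icc 1 (n / 2)) : ∃ s : Finset (Finset (Fin n)),
    (∀ T, T ∈ s ↔ T.card = h ∧ IsFactor T) ∧ pP n h = ∏ T ∈ s, lamT n T := by
  rw [Finset.mem_Icc] at hh
  unfold pP
  split_ifs with hlt
  · refine ⟨_, fun T => ?_, rfl⟩
    simp only [Finset.mem_powersetCard, Finset.subset_univ, true_and, IsFactor]
    exact ⟨fun h => ⟨h, Or.inl (by omega)⟩, fun h => h.1⟩
  · refine ⟨_, fun T => ?_, rfl⟩
    simp only [Finset.mem_filter, Finset.mem_powersetCard, Finset.subset_univ, true_and, IsFactor]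
    refine and_congr_right fun h => ⟨fun h' => Or.inr ⟨by omega, h'⟩, fun h' => ?_⟩
    exact (h'.resolve_left (by omega)).2

theorem IsFactor.card_le {n : ℕ} {T : Finset (Fin n)} (h : IsFactor T) : T.card ≤ n / 2 := by
  rcases h with h | h <;> omega

theorem lamT_dvd_qP {n : ℕ} {T : Finset (Fin n)} (hT : T.Nonempty) (hT' : T ≠ Finset.univ) :
    lamT n T ∣ qP n := by
  have key : ∀ S : Finset (Fin n), S.Nonempty → IsFactor S → lamT n S ∣ qP n := by
    intro S hS hF
    have hh : S.card ∈ Finset.Icc 1 (n / 2) := Finset.mem_Icc.2 ⟨hS.card_pos, hF.card_le⟩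
    obtain ⟨s, hs, he⟩ := pP_eq hh
    exact (he ▸ Finset.dvd_prod_of_mem _ ((hs S).2 ⟨rfl, hF⟩)).trans (Finset.dvd_prod_of_mem _ hh)
  by_cases hF : IsFactor T
  · exact key T hT hF
  · rw [← neg_dvd, ← lamT_compl]
    refine key _ (Finset.nonempty_iff_ne_empty.2 (by simpa using hT')) ?_
    have hc := Finset.card_compl_add_card T
    rw [Fintype.card_fin] at hc
    simp only [IsFactor, not_or, not_lt, not_and, Finset.mem_compl] at hF ⊢
    rcases hF.1.lt_or_eq with h | h
    · left; omega
    · refine Or.inr ⟨by omega, ?_⟩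
      obtain ⟨x, hx⟩ := hT
      exact ⟨⟨0, x.pos⟩, fun h0 => hF.2 h.symm ⟨_, h0, rfl⟩, rfl⟩

theorem qP_dvd {n : ℕ} {f : MvPolynomial (Fin (n - 1)) ℂ}
    (hf : ∀ T : Finset (Fin n), T.Nonempty → T ≠ Finset.univ → lamT n T ∣ f) : qP n ∣ f := by
  have hne : ∀ {T : Finset (Fin n)}, T.card ∈ Finset.Icc 1 (n / 2) →
      T.Nonempty ∧ T ≠ Finset.univ := by
    intro T hT
    rw [Finset.mem_Icc] at hT
    refine ⟨Finset.card_pos.1 (by omega), ?_⟩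
    rintro rfl
    rw [Finset.card_univ, Fintype.card_fin] at hT
    omega
  have hrel : ∀ {T T' : Finset (Fin n)}, T.card ∈ Finset.Icc 1 (n / 2) →
      T'.card ∈ Finset.Icc 1 (n / 2) → IsFactor T → IsFactor T' → T ≠ T' →
      IsRelPrime (lamT n T) (lamT n T') := by
    intro T T' hT hT' hF hF' hTT
    refine isRelPrime_lamT (hne hT).1 (hne hT).2 (hne hT').1 (hne hT').2 hTT.symm ?_
    rintro rfl
    have hc := Finset.card_compl_add_card T
    rw [Fintype.card_fin] at hc
    have h1 := hF.card_le
    have h2 := hF'.card_le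
    obtain ⟨i, hi, hi0⟩ := (hF.resolve_left (by omega)).2
    obtain ⟨j, hj, hj0⟩ := (hF'.resolve_left (by omega)).2
    exact Finset.mem_compl.1 hj ((Fin.ext (hi0.trans hj0.symm) : i = j) ▸ hi)
  refine Finset.prod_dvd_of_isRelPrime ?_ ?_
  · intro h hh h' hh' hne
    obtain ⟨s, hs, he⟩ := pP_eq hh
    obtain ⟨s', hs', he'⟩ := pP_eq hh'
    rw [Function.onFun, he, he']
    refine IsRelPrime.prod_left fun T hT => IsRelPrime.prod_right fun T' hT' => ?_
    obtain ⟨rfl, hF⟩ := (hs T).1 hT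
    obtain ⟨rfl, hF'⟩ := (hs' T').1 hT'
    exact hrel hh hh' hF hF' fun h => hne (congrArg Finset.card h)
  · intro h hh
    obtain ⟨s, hs, he⟩ := pP_eq hh
    rw [he]
    refine Finset.prod_dvd_of_isRelPrime ?_ ?_
    · intro T hT T' hT' hTT
      obtain ⟨hc, hF⟩ := (hs T).1 hT
      obtain ⟨hc', hF'⟩ := (hs T').1 hT'
      exact hrel (hc ▸ hh) (hc' ▸ hh) hF hF' hTT
    · intro T hT
      obtain ⟨rfl, -⟩ := (hs T).1 hT
      exact hf T (hne hh).1 (hne hh).2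

theorem lamT_dvd_of_card_eq {n g : ℕ} {f : MvPolynomial (Fin (n - 1)) ℂ}
    (hf : f ∈ SigmaBar n g) {T T' : Finset (Fin n)} (hT : lamT n T ∣ f)
    (hc : T.card = T'.card) : lamT n T' ∣ f := by
  set σ : Equiv.Perm (Fin n) := (Finset.equivOfCardEq hc).extendSubtype with hσ
  have hmap : T.map σ.toEmbedding = T' := by
    refine Finset.eq_of_subset_of_card_le ?_ (by rw [Finset.card_map, hc])
    intro x hx
    obtain ⟨y, hy, rfl⟩ := Finset.mem_map.1 hx
    exact Equiv.extendSubtype_mem _ y hy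
  have h := map_dvd (permAct n σ) hT
  rw [permAct_eq_of_mem_SigmaBar hf] at h
  convert h
  rw [← hmap, lamT, lamT, Finset.sum_map, map_sum]
  exact Finset.sum_congr rfl fun i _ => (permAct_lamb σ i).symm

/-- `theta` expressed through the coefficients `U` of the potenziante. -/
theorem theta_eq_sum {n g : ℕ} {U : (Fin n → ℕ) → MvPolynomial ℕ ℂ}
    (hU : pot n g = ∑ k ∈ wtT n g,
      (∏ i : Fin n, esymm (Fin n) ℂ ((i : ℕ) + 1) ^ k i) ⊗ₜ[ℂ] U k)
    (hn : 0 < n) (φ : Module.Dual ℂ (MvPolynomial (Fin (n - 1)) ℂ)) :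
    theta n g φ = ∑ k ∈ wtT' n g,
      φ (∏ i : Fin (n - 1), ebar n ((i : ℕ) + 2) ^ k i) • U (extend0 k) := by
  have haes : ∀ j, aeval (lamb n) (esymm (Fin n) ℂ j) = ebar n j := fun j => by
    simp [esymm, ebar]
  have h := congrArg (TensorProduct.lift (LinearMap.lsmul ℂ (MvPolynomial ℕ ℂ) ∘ₗ
    φ ∘ₗ (aeval (lamb n)).toLinearMap)) hU
  simp only [pot, map_sum, TensorProduct.lift.tmul, LinearMap.comp_apply, AlgHom.toLinearMap_apply,
    map_prod, map_pow, aeval_X, haes, LinearMap.lsmul_apply] at h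
  obtain ⟨m, rfl⟩ : ∃ m, n = m + 1 := ⟨n - 1, by omega⟩
  have he0 : ∀ k : Fin m → ℕ, extend0 (n := m + 1) k 0 = 0 := fun k => by simp [extend0]
  have hes : ∀ (k : Fin m → ℕ) i, extend0 (n := m + 1) k (Fin.succ i) = k i := fun k i => by
    simp [extend0]
  refine h.trans (Finset.sum_of_injOn extend0 ?_ ?_ ?_ ?_).symm
  · intro k _ k' _ hkk
    funext i
    rw [← hes k, hkk, hes]
  · intro k hk
    simp only [wtT', wtT, Finset.mem_coe, Finset.mem_filter, Fintype.mem_piFinset,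
      Finset.mem_range, Fin.sum_univ_succ] at hk ⊢
    refine ⟨fun i => ?_, ?_⟩
    · induction i using Fin.cases with
      | zero => simp [he0]
      | succ i => simpa [hes] using hk.1 i
    · simpa [he0, hes, add_assoc] using hk.2
  · intro k hk hk'
    have h0 : k 0 ≠ 0 := by
      intro h0
      apply hk'
      refine ⟨fun i => k (Fin.succ i), ?_, ?_⟩
      · simp only [wtT', wtT, Finset.mem_coe, Finset.mem_filter, Fintype.mem_piFinset,
          Finset.mem_range, Fin.sum_univ_succ] at hk ⊢
        exact ⟨fun i => hk.1 _, by simpa [h0, add_assoc] using hk.2⟩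
      · funext i
        induction i using Fin.cases with
        | zero => rw [he0, h0]
        | succ i => rw [hes]
    have he1 : ebar (m + 1) 1 = 0 := by
      simp [ebar, Finset.powersetCard_one, sum_lamb]
    rw [Fin.prod_univ_succ]
    simp [he1, h0]
  · intro k _
    rw [Fin.prod_univ_succ, he0, pow_zero, one_mul]
    simp only [hes, Fin.val_succ]
    rfl

theorem eq_zero_of_dualDistrib {V W : Type*} [AddCommGroup V] [Module ℂ V] [AddCommGroup W]
    [Module ℂ W] {z : V ⊗[ℂ] W}
    (h : ∀ φ₁ φ₂, dualDistrib ℂ V W (φ₁ ⊗ₜ φ₂) z = 0) : z = 0 := by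
  let b := Module.Basis.ofVectorSpace ℂ V
  let c := Module.Basis.ofVectorSpace ℂ W
  refine (b.tensorProduct c).ext_elem fun ij => ?_
  rw [map_zero, Finsupp.zero_apply, ← h (b.coord ij.1) (c.coord ij.2)]
  have : (b.tensorProduct c).coord ij = dualDistrib ℂ V W (b.coord ij.1 ⊗ₜ c.coord ij.2) :=
    TensorProduct.ext' fun x y => by
      rw [Module.Basis.coord_apply]
      rcases ij with ⟨i, j⟩
      rw [Module.Basis.tensorProduct_repr_tmul_apply]
      simp [mul_comm]
  exact DFunLike.congr_fun this z

/-- for `n > 2`, the ℂ-linear map `Φ` from the dual of `Σ̄_{n,g}` to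
`S_{n,g}`, `Φ(ψ) = ∑_k ψ(ē₂^{k₂}⋯ēₙ^{kₙ})·U_{k₂,…,kₙ}` (sum over `2k₂+⋯+nkₙ = g`), is
a linear isomorphism onto `S_{n,g}`, and `Φ` maps the annihilator of
`O_{n,g} = Σ̄_{n,g} ∩ qₙ·Aₙ` onto the space `Dec_{n,g}` of decomposable `U`-invariants.
Here `U` comes from the expansion of the potenziante in the elementary symmetric
monomials (`U_{k₂,…,kₙ} = Ũ_{0,k₂,…,kₙ}`), and `E k` is `ē₂^{k₂}⋯ēₙ^{kₙ}` as an
element of `Σ̄_{n,g}`. -/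
theorem stmt12
    (D : Derivation ℂ (MvPolynomial ℕ ℂ) (MvPolynomial ℕ ℂ))
    (hD0 : D (X 0) = 0) (hD : ∀ i : ℕ, D (X (i + 1)) = X i)
    (n : ℕ) (hn : 2 < n) (g : ℕ)
    (U : (Fin n → ℕ) → MvPolynomial ℕ ℂ)
    (hU : ∀ g' : ℕ, pot n g' =
      ∑ k ∈ wtT n g',
        (∏ i : Fin n, esymm (Fin n) ℂ ((i : ℕ) + 1) ^ k i) ⊗ₜ[ℂ] U k)
    (E : (Fin (n - 1) → ℕ) → ↥(SigmaBar n g))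
    (hE : ∀ k ∈ wtT' n g,
      (E k : MvPolynomial (Fin (n - 1)) ℂ) =
        ∏ i : Fin (n - 1), ebar n ((i : ℕ) + 2) ^ k i)
    (Φ : Module.Dual ℂ ↥(SigmaBar n g) →ₗ[ℂ] MvPolynomial ℕ ℂ)
    (hΦ : ∀ ψ : Module.Dual ℂ ↥(SigmaBar n g),
      Φ ψ = ∑ k ∈ wtT' n g, ψ (E k) • U (extend0 k)) :
    Function.Injective Φ ∧
    LinearMap.range Φ = Sng D n g ∧
    Submodule.map Φ
        (Submodule.dualAnnihilator
          (Submodule.comap (SigmaBar n g).subtype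
            ((Ideal.span {qP n}).restrictScalars ℂ))) =
      Dec D n g := by
  have hΦθ : ∀ φ : Module.Dual ℂ (MvPolynomial (Fin (n - 1)) ℂ),
      Φ (φ ∘ₗ (SigmaBar n g).subtype) = theta n g φ := fun φ => by
    rw [hΦ, theta_eq_sum (hU g) (by omega)]
    refine Finset.sum_congr rfl fun k hk => ?_
    rw [LinearMap.comp_apply, Submodule.subtype_apply, hE k hk]
  have hext : ∀ ψ : Module.Dual ℂ ↥(SigmaBar n g), ∃ φ, φ ∘ₗ (SigmaBar n g).subtype = ψ :=
    fun ψ => LinearMap.exists_extend ψ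
  have hrange : LinearMap.range Φ = Sng D n g := by
    refine le_antisymm ?_ fun p hp => ?_
    · rintro _ ⟨ψ, rfl⟩
      obtain ⟨φ, rfl⟩ := hext ψ
      exact hΦθ φ ▸ theta_mem_Sng hD0 hD n g φ
    · obtain ⟨φ, -, rfl⟩ := exists_theta_eq hD0 hD hp
      exact ⟨_, hΦθ φ⟩
  refine ⟨(injective_iff_map_eq_zero Φ).2 fun ψ hψ => ?_, hrange, le_antisymm ?_ ?_⟩
  · obtain ⟨φ, rfl⟩ := hext ψ
    rw [hΦθ] at hψ
    exact LinearMap.ext fun f => apply_eq_zero_of_theta_eq_zero hψ f.2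
  · have : Module.Finite ℂ (homogeneousSubmodule (Fin (n - 1)) ℂ g) :=
      Module.Finite.iff_fg.2 (homogeneousSubmodule_fg _ _ _)
    have : Module.Finite ℂ (SigmaBar n g) :=
      Submodule.finiteDimensional_of_le inf_le_left
    rw [Submodule.map_le_iff_le_comap, ← Subspace.dualCoannihilator_dualAnnihilator_eq
      (W := (Dec D n g).comap Φ)]
    refine Submodule.dualAnnihilator_anti fun f hf => ?_
    refine Ideal.mem_span_singleton.2 (qP_dvd fun T hT hT' => ?_)
    obtain ⟨h, k, hh, rfl⟩ : ∃ h k, T.card = h ∧ n = h + k :=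
      ⟨_, n - T.card, rfl, by
        have := T.card_le_univ
        rw [Fintype.card_fin] at this
        omega⟩
    have hlt := (Finset.card_lt_iff_ne_univ T).2 hT'
    rw [Fintype.card_fin] at hlt
    have hpos := hT.card_pos
    refine lamT_dvd_of_card_eq (T := Finset.univ.map (Fin.castAddEmb k)) f.2
      (lamT_dvd_of_splitA_eq_zero (eq_zero_of_dualDistrib fun φ₁ φ₂ => ?_)) (by simp [hh])
    refine (Submodule.mem_dualCoannihilator _).1 hf
      ((dualDistrib ℂ _ _ (φ₁ ⊗ₜ φ₂) ∘ₗ (splitA h k).toLinearMap) ∘ₗ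
        (SigmaBar (h + k) g).subtype) ?_
    rw [Submodule.mem_comap, hΦθ, theta_splitA]
    refine Submodule.sum_mem _ fun p hp => ?_
    rw [Finset.HasAntidiagonal.mem_antidiagonal] at hp
    refine Submodule.mem_iSup_of_mem h (Submodule.mem_iSup_of_mem (Finset.mem_Icc.2 (by omega))
      (Submodule.mem_iSup_of_mem p.1 (Submodule.mem_iSup_of_mem
        (Finset.mem_range.2 (by omega)) ?_)))
    rw [Nat.add_sub_cancel_left, show g - p.1 = p.2 by omega]
    exact Submodule.mul_mem_mul (theta_mem_Sng hD0 hD h p.1 φ₁) (theta_mem_Sng hD0 hD k p.2 φ₂)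
  · refine iSup₂_le fun h hh => iSup₂_le fun j hj => Submodule.mul_le.2 fun p₁ hp₁ p₂ hp₂ => ?_
    rw [Finset.mem_Icc] at hh
    rw [Finset.mem_range] at hj
    obtain ⟨k, rfl⟩ : ∃ k, n = h + k := ⟨n - h, by omega⟩
    rw [Nat.add_sub_cancel_left] at hp₂
    obtain ⟨φ₁, hφ₁, rfl⟩ := exists_theta_eq hD0 hD hp₁
    obtain ⟨φ₂, -, rfl⟩ := exists_theta_eq hD0 hD hp₂
    refine ⟨(dualDistrib ℂ _ _ (φ₁ ⊗ₜ φ₂) ∘ₗ (splitA h k).toLinearMap) ∘ₗ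
        (SigmaBar (h + k) g).subtype, ?_, ?_⟩
    · refine (Submodule.mem_dualAnnihilator _).2 fun f hf => ?_
      have hT : lamT (h + k) (Finset.univ.map (Fin.castAddEmb k)) ∣ f :=
        (lamT_dvd_qP (by simp [← Finset.card_pos]; omega) fun hu => by
          have := congrArg Finset.card hu
          simp only [Finset.card_map, Finset.card_univ, Fintype.card_fin] at this
          omega).trans (Ideal.mem_span_singleton.1 hf)
      obtain ⟨q, hq⟩ := hT
      simp [hq, splitA_lamT]
    · rw [hΦθ, theta_splitA]
      refine Finset.sum_eq_single_of_mem (j, g - j)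
        (Finset.HasAntidiagonal.mem_antidiagonal.2 (by simp; omega)) fun p hp hne => ?_
      rw [Finset.HasAntidiagonal.mem_antidiagonal] at hp
      have hne' : p.1 ≠ j := fun h0 => hne (Prod.ext h0 (by simp; omega))
      have h0 : theta h p.1 φ₁ = 0 := by
        rw [theta, tupleComb]
        refine Finset.sum_eq_zero fun r hr => ?_
        rw [Finset.Nat.mem_antidiagonalTuple] at hr
        rw [hφ₁ r (hr ▸ hne'), zero_smul]
      rw [h0, zero_mul]
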